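/- Let n ≥ 4 be a natural number. There exists a real number A > 1 such that for every a > A, the function f_a has exactly one zero: the set {z ∈ ℂ, z ≠ 0 : f_a(z) = 0} has exactly one element. -/

import Mathlib

/-- The family of complex-valued harmonic functions
`f_a(z) = (a/(n+1))·z^(n+1) − (1/n)·z^(−n) + (1/(n+1))·(conj z)^(n+1) − (a/n)·(conj z)^(−n) − 1`. -/
noncomputable def fa (n : ℕ) (a : ℝ) (z : ℂ) : ℂ :=
  ((a : ℂ) / ((n : ℂ) + 1)) * z ^ (n + 1) - (1 / (n : ℂ)) * z ^ (-(n : ℤ)) +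
    (1 / ((n : ℂ) + 1)) * (starRingEnd ℂ z) ^ (n + 1) -
    ((a : ℂ) / (n : ℂ)) * (starRingEnd ℂ z) ^ (-(n : ℤ)) - 1

/-- The imaginary part of a power is controlled by the imaginary part of the base. -/
theorem abs_im_pow_succ_le (w : ℂ) (k : ℕ) :
    |(w ^ (k + 1)).im| ≤ (k + 1) * |w.im| * ‖w‖ ^ k := by
  induction k with
  | zero => simp
  | succ k ih =>
    have h1 : |(w ^ (k + 1)).re| ≤ ‖w‖ ^ (k + 1) := by
      simpa using Complex.abs_re_le_norm (w ^ (k + 1))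
    calc |(w ^ (k + 1 + 1)).im|
        = |(w ^ (k + 1)).re * w.im + (w ^ (k + 1)).im * w.re| := by
          rw [pow_succ w (k + 1), Complex.mul_im]
      _ ≤ |(w ^ (k + 1)).re| * |w.im| + |(w ^ (k + 1)).im| * |w.re| := by
          rw [← abs_mul, ← abs_mul]
          exact abs_add_le _ _
      _ ≤ ‖w‖ ^ (k + 1) * |w.im| + ((k + 1) * |w.im| * ‖w‖ ^ k) * ‖w‖ := by
          gcongr
          exact Complex.abs_re_le_norm w
      _ = ((k + 1 : ℕ) + 1) * |w.im| * ‖w‖ ^ (k + 1) := by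
          push_cast
          ring

open ComplexConjugate in
/-- Away from the origin and for `a > 1`, the zeros of `fa n a` are the solutions of a
harmonic-type equation without poles. -/
theorem fa_eq_zero_iff {n : ℕ} (hn : n ≠ 0) {a : ℝ} (ha : 1 < a) {z : ℂ} (hz : z ≠ 0) :
    fa n a z = 0 ↔
      (n : ℂ) * (a + 1) * (z * ((‖z‖ ^ (2 * n) : ℝ) : ℂ)) =
        (n + 1) * (a + 1) + n * (n + 1) * conj z ^ n := by
  have hw : conj z ≠ 0 := by simpa using hz
  have hn0 : (n : ℂ) ≠ 0 := by exact_mod_cast hn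
  have hn1 : (n : ℂ) + 1 ≠ 0 := by exact_mod_cast n.succ_ne_zero
  have ha1 : (a : ℂ) + 1 ≠ 0 := by
    exact_mod_cast (by linarith : a + 1 ≠ 0)
  have ha2 : (a : ℂ) - 1 ≠ 0 := by
    exact_mod_cast (by linarith : a - 1 ≠ 0)
  have hnorm : ((‖z‖ ^ (2 * n) : ℝ) : ℂ) = z ^ n * conj z ^ n := by
    rw [← mul_pow, Complex.mul_conj', ← pow_mul]
    push_cast
    rfl
  set P : ℂ := z ^ (n + 1) / (n + 1) - (conj z ^ n)⁻¹ / n with hP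
  have hPc : conj P = conj z ^ (n + 1) / (n + 1) - (z ^ n)⁻¹ / n := by
    simp [hP]
  have hf : fa n a z = a * P + conj P - 1 := by
    rw [hPc, hP, fa, zpow_neg, zpow_neg, zpow_natCast, zpow_natCast]
    ring
  have key : fa n a z = 0 ↔ (a + 1) * P = 1 := by
    rw [hf]
    constructor
    · intro h
      have h' : (a : ℂ) * conj P + P - 1 = 0 := by
        simpa using congrArg conj h
      have h2 : ((a : ℂ) - 1) * (P - conj P) = 0 := by linear_combination h - h'
      have h3 := (mul_eq_zero.mp h2).resolve_left ha2
      linear_combination h + h3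
    · intro h
      have h' : ((a : ℂ) + 1) * conj P = 1 := by
        simpa using congrArg conj h
      have h3 : conj P = P := mul_left_cancel₀ ha1 (h'.trans h.symm)
      rw [h3]
      linear_combination h
  rw [key, hnorm, hP]
  have hwn : conj z ^ n ≠ 0 := pow_ne_zero n hw
  field_simp
  constructor <;> intro h <;> linear_combination h

/-- For large `a`, every solution of the pole-free equation lies on the positive real axis. -/
theorem eq_norm_of_fa_eq_zero {n : ℕ} (hn : n ≠ 0) {a : ℝ} (ha : (n : ℝ) * (n + 1) < a)
    {z : ℂ} (hz : z ≠ 0) (h : fa n a z = 0) : z = (‖z‖ : ℂ) := by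
  have hn1 : (1 : ℝ) ≤ n := by exact_mod_cast Nat.one_le_iff_ne_zero.mpr hn
  have ha1 : 1 < a := by nlinarith
  rw [fa_eq_zero_iff hn ha1 hz] at h
  set r := ‖z‖ with hr
  have hr0 : 0 < r := norm_pos_iff.mpr hz
  have hre : (n : ℝ) * (a + 1) * (z.re * r ^ (2 * n)) =
      (n + 1) * (a + 1) + n * (n + 1) * ((starRingEnd ℂ z) ^ n).re := by
    have := congrArg Complex.re h
    simpa [-Complex.ofReal_pow, Complex.mul_re, Complex.mul_im, ← map_pow] using this
  have him : (n : ℝ) * (a + 1) * (z.im * r ^ (2 * n)) =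
      n * (n + 1) * ((starRingEnd ℂ z) ^ n).im := by
    have := congrArg Complex.im h
    simpa [-Complex.ofReal_pow, Complex.mul_re, Complex.mul_im, ← map_pow] using this
  have hb : |((starRingEnd ℂ z) ^ n).re| ≤ r ^ n := by
    simpa [-map_pow] using Complex.abs_re_le_norm ((starRingEnd ℂ z) ^ n)
  have hbl := (abs_le.mp hb).1
  have hzr : |z.re| ≤ r := Complex.abs_re_le_norm z
  have hrn : 0 < r ^ n := pow_pos hr0 n
  have hi : z.im = 0 := by
    by_contra hne
    have hip : 0 < |z.im| := abs_pos.mpr hne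
    obtain ⟨k, rfl⟩ := Nat.exists_eq_add_one_of_ne_zero hn
    have hk := abs_im_pow_succ_le (starRingEnd ℂ z) k
    rw [Complex.norm_conj, Complex.conj_im, abs_neg, ← hr] at hk
    have habs := congrArg abs him
    simp only [abs_mul, abs_pow] at habs
    push_cast at *
    rw [abs_of_pos (by linarith : 0 < a + 1), abs_of_pos (by linarith : (0 : ℝ) < k + 1),
      abs_of_pos hr0, abs_of_pos (by linarith : (0 : ℝ) < (k : ℝ) + 1 + 1)] at habs
    have hrk : 0 < r ^ k := pow_pos hr0 k
    have h1 : (a + 1) * r ^ (k + 2) ≤ (k + 1) * (k + 2) := by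
      have h2 : ((k + 1) * |z.im| * r ^ k) * ((a + 1) * r ^ (k + 2)) ≤
          ((k + 1) * |z.im| * r ^ k) * ((k + 1) * (k + 2)) := by
        calc _ = ((k : ℝ) + 1) * (a + 1) * (|z.im| * r ^ (2 * (k + 1))) := by ring
          _ = _ := habs
          _ ≤ ((k : ℝ) + 1) * (k + 1 + 1) * ((k + 1) * |z.im| * r ^ k) := by gcongr
          _ = _ := by ring
      exact le_of_mul_le_mul_left h2 (by positivity)
    have hr1 : r < 1 := by
      by_contra! hge
      have := one_le_pow₀ hge (n := k + 2)
      nlinarith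
    have hpow : r ^ (k + 1) ≤ 1 := pow_le_one₀ hr0.le hr1.le
    have h3 : ((k : ℝ) + 1) * (a + 1) * (z.re * r ^ (2 * (k + 1))) ≤
        (k + 1) * ((k + 1) * (k + 2)) := by
      calc ((k : ℝ) + 1) * (a + 1) * (z.re * r ^ (2 * (k + 1)))
          ≤ ((k : ℝ) + 1) * (a + 1) * (r * r ^ (2 * (k + 1))) := by
            gcongr
            exact (le_abs_self _).trans hzr
        _ = (k + 1) * (((a + 1) * r ^ (k + 2)) * r ^ (k + 1)) := by ring
        _ ≤ (k + 1) * (((k + 1) * (k + 2)) * 1) := by gcongr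
        _ = _ := by ring
    have h4 : -(((k : ℝ) + 1) * (k + 1 + 1)) ≤
        ((k : ℝ) + 1) * (k + 1 + 1) * ((starRingEnd ℂ z) ^ (k + 1)).re := by
      have : (0 : ℝ) < ((k : ℝ) + 1) * (k + 1 + 1) := by positivity
      nlinarith
    have h5 : ((k : ℝ) + 1 + 1) * ((k + 1) * (k + 1 + 1)) < (k + 1 + 1) * a := by gcongr
    nlinarith
  have hpos : 0 ≤ z.re := by
    by_contra! hneg
    have hzabs : r = -z.re := by
      rw [hr, ← Complex.abs_re_eq_norm.mpr hi, abs_of_neg hneg]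
    have hre' : (n : ℝ) * (a + 1) * (r ^ (n + 1) * r ^ n) + (n + 1) * (a + 1) ≤
        n * (n + 1) * r ^ n := by
      have h5 : -((n : ℝ) * (n + 1) * r ^ n) ≤
          n * (n + 1) * ((starRingEnd ℂ z) ^ n).re := by
        rw [← mul_neg]
        gcongr
      have h6 : (n : ℝ) * (a + 1) * (z.re * r ^ (2 * n)) =
          -((n : ℝ) * (a + 1) * (r ^ (n + 1) * r ^ n)) := by
        rw [show z.re = -r by linarith]
        ring
      linarith
    rcases le_total r 1 with h1 | h1
    · have h7 : r ^ n ≤ 1 := pow_le_one₀ hr0.le h1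
      have h8 : 0 ≤ (n : ℝ) * (a + 1) * (r ^ (n + 1) * r ^ n) := by positivity
      have h9 : (n : ℝ) * (n + 1) * r ^ n ≤ n * (n + 1) * 1 := by gcongr
      nlinarith
    · have h7 : 1 ≤ r ^ (n + 1) := one_le_pow₀ h1
      have h8 : (n : ℝ) * (a + 1) * (1 * r ^ n) ≤ n * (a + 1) * (r ^ (n + 1) * r ^ n) := by
        gcongr
      have h9 : (n : ℝ) * (n + 1) * r ^ n ≤ n * (a + 1) * (1 * r ^ n) := by
        rw [one_mul]
        gcongr
        nlinarith
      nlinarith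
  have hrr : r = z.re := by
    rw [hr, ← Complex.abs_re_eq_norm.mpr hi, abs_of_nonneg hpos]
  apply Complex.ext
  · simp [hrr]
  · simp [hi]

/-- On the positive real axis, the zeros of `fa n a` are the roots of a real polynomial. -/
theorem fa_ofReal_eq_zero_iff {n : ℕ} (hn : n ≠ 0) {a : ℝ} (ha : 1 < a) {r : ℝ} (hr : 0 < r) :
    fa n a (r : ℂ) = 0 ↔
      n * (a + 1) * r ^ (2 * n + 1) = (n + 1) * (a + 1) + n * (n + 1) * r ^ n := by
  rw [fa_eq_zero_iff hn ha (by exact_mod_cast hr.ne'), Complex.norm_real, Complex.conj_ofReal,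
    Real.norm_of_nonneg hr.le, pow_succ' r (2 * n)]
  norm_cast

/-- The polynomial equation on the positive real axis has at most one solution. -/
theorem le_of_real_equation {n : ℕ} {a r s : ℝ} (hn : n ≠ 0) (ha : 1 < a)
    (hr : 0 < r) (hs : 0 < s)
    (h1 : n * (a + 1) * r ^ (2 * n + 1) = (n + 1) * (a + 1) + n * (n + 1) * r ^ n)
    (h2 : n * (a + 1) * s ^ (2 * n + 1) = (n + 1) * (a + 1) + n * (n + 1) * s ^ n) :
    r ≤ s := by
  by_contra! hlt
  have hn0 : (0 : ℝ) < n := by exact_mod_cast Nat.pos_of_ne_zero hn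
  have hrn : 0 < r ^ n := pow_pos hr n
  have hsn : 0 < s ^ n := pow_pos hs n
  have hp : s ^ n < r ^ n := pow_lt_pow_left₀ hlt hs.le hn
  have hp1 : s ^ (n + 1) < r ^ (n + 1) := pow_lt_pow_left₀ hlt hs.le n.succ_ne_zero
  have h3 : n * (a + 1) * (r ^ n * s ^ n) * (r ^ (n + 1) - s ^ (n + 1)) =
      (n + 1) * (a + 1) * (s ^ n - r ^ n) := by
    linear_combination s ^ n * h1 - r ^ n * h2
  have h4 : 0 < n * (a + 1) * (r ^ n * s ^ n) * (r ^ (n + 1) - s ^ (n + 1)) := by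
    have := sub_pos.mpr hp1
    positivity
  have h5 : 0 < (n + 1) * (a + 1) * (r ^ n - s ^ n) := by
    have := sub_pos.mpr hp
    positivity
  linarith

/-- The polynomial equation on the positive real axis has a solution. -/
theorem exists_real_equation {n : ℕ} (hn : n ≠ 0) {a : ℝ} (ha : (n : ℝ) < a) :
    ∃ r : ℝ, 0 < r ∧
      n * (a + 1) * r ^ (2 * n + 1) = (n + 1) * (a + 1) + n * (n + 1) * r ^ n := by
  have hn1 : (1 : ℝ) ≤ n := by exact_mod_cast Nat.one_le_iff_ne_zero.mpr hn
  let g : ℝ → ℝ := fun r ↦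
    n * (a + 1) * r ^ (2 * n + 1) - ((n + 1) * (a + 1) + n * (n + 1) * r ^ n)
  have hg : ContinuousOn g (Set.Icc 0 2) := by
    dsimp only [g]
    fun_prop
  have h0 : g 0 < 0 := by
    simp only [g, zero_pow hn, zero_pow (2 * n).succ_ne_zero]
    nlinarith
  have h2 : 0 ≤ g 2 := by
    have hc : 0 ≤ (n : ℝ) * (a + 1) := by nlinarith
    have hx : (2 : ℝ) ≤ 2 ^ n := le_self_pow₀ one_le_two hn
    have hsq : (2 : ℝ) ^ (2 * n + 1) = 2 * (2 ^ n * 2 ^ n) := by ring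
    simp only [g, hsq]
    have e1 : (n : ℝ) * (a + 1) * (2 * 2 ^ n) ≤ n * (a + 1) * (2 ^ n * 2 ^ n) := by gcongr
    have e2 : (n : ℝ) * (n + 1) * 2 ^ n ≤ n * (a + 1) * 2 ^ n := by gcongr
    have e3 : (n : ℝ) * (a + 1) * 2 ≤ n * (a + 1) * 2 ^ n := by gcongr
    nlinarith
  obtain ⟨r, hr, hgr⟩ := intermediate_value_Icc (by norm_num) hg ⟨h0.le, h2⟩
  refine ⟨r, hr.1.lt_of_ne ?_, sub_eq_zero.mp hgr⟩
  rintro rfl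
  exact h0.ne hgr

/-- For all sufficiently large `a`, the function `f_a` has exactly one zero. -/
theorem one_zero_for_large_a (n : ℕ) (hn : 4 ≤ n) :
    ∃ A : ℝ, 1 < A ∧ ∀ a : ℝ, A < a →
      {z : ℂ | z ≠ 0 ∧ fa n a z = 0}.ncard = 1 := by
  have hn0 : n ≠ 0 := by omega
  have hn4 : (4 : ℝ) ≤ n := by exact_mod_cast hn
  refine ⟨n * (n + 1), by nlinarith, fun a ha ↦ ?_⟩
  have ha1 : 1 < a := by nlinarith
  obtain ⟨r, hr, hroot⟩ := exists_real_equation hn0 (show (n : ℝ) < a by nlinarith)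
  rw [Set.ncard_eq_one]
  refine ⟨(r : ℂ), Set.eq_singleton_iff_unique_mem.mpr ⟨⟨by exact_mod_cast hr.ne',
    (fa_ofReal_eq_zero_iff hn0 ha1 hr).mpr hroot⟩, ?_⟩⟩
  rintro z ⟨hz, hfz⟩
  have hzr := eq_norm_of_fa_eq_zero hn0 ha hz hfz
  have hzpos : 0 < ‖z‖ := norm_pos_iff.mpr hz
  rw [hzr] at hfz
  have hzroot := (fa_ofReal_eq_zero_iff hn0 ha1 hzpos).mp hfz
  rw [hzr, le_antisymm (le_of_real_equation hn0 ha1 hzpos hr hzroot hroot)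
    (le_of_real_equation hn0 ha1 hr hzpos hroot hzroot)]
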